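/- arXiv:1701.05538 — 2 statements merged into one kernel-verified Lean document; each statement's English description precedes it below -/
import Mathlib

section
/- Let f : 𝕋 → ℂ be continuous with sup_{ζ ∈ 𝕋} |f(ζ)| ≤ 1, and let ε > 0. Then there exist finite Blaschke products B_{i1}, B_{i2} for 1 ≤ i ≤ n (with each B_{i2} nonvanishing on 𝕋) and nonnegative reals λ₁, …, λ_n with λ₁ + ⋯ + λ_n = 1, such that sup_{ζ ∈ 𝕋} |λ₁B_{11}(ζ)/B_{12}(ζ) + ⋯ + λ_nB_{n1}(ζ)/B_{n2}(ζ) − f(ζ)| < ε. Consequently, the closed convex hull of quotients of finite Blaschke products equals the closed unit ball of C(𝕋). -/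
open Complex Metric Set

/-- The finite Blaschke product with unimodular constant `c` and zeros parameters `a k ∈ 𝔻`. -/
noncomputable def finBlaschke (n : ℕ) (c : ℂ) (a : Fin n → ℂ) : ℂ → ℂ :=
  fun z => c * ∏ k, (a k - z) / (1 - (starRingEnd ℂ) (a k) * z)

/-- `f` is a finite Blaschke product on the set `s`. -/
def IsFiniteBlaschkeOn (f : ℂ → ℂ) (s : Set ℂ) : Prop :=
  ∃ (n : ℕ) (c : ℂ) (a : Fin n → ℂ),
    ‖c‖ = 1 ∧ (∀ k, ‖a k‖ < 1) ∧ Set.EqOn f (finBlaschke n c a) s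

theorem finBlaschke_ne_zero {n : ℕ} {c : ℂ} {a : Fin n → ℂ} (hc : ‖c‖ = 1)
    (ha : ∀ k, ‖a k‖ < 1) {z : ℂ} (hz : z ∈ sphere (0 : ℂ) 1) : finBlaschke n c a z ≠ 0 := by
  have hz1 : ‖z‖ = 1 := by simpa using hz
  refine mul_ne_zero (fun h => by simp [h] at hc) (Finset.prod_ne_zero_iff.2 fun k _ => ?_)
  refine div_ne_zero (fun h => ?_) (fun h => ?_)
  · have := ha k
    rw [sub_eq_zero.1 h, hz1] at this
    exact lt_irrefl _ this
  · have h1 : ‖(starRingEnd ℂ) (a k) * z‖ = 1 := by rw [← sub_eq_zero.1 h, norm_one]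
    rw [norm_mul, hz1, RCLike.norm_conj, mul_one] at h1
    exact (ha k).ne h1

theorem IsFiniteBlaschkeOn.ne_zero {B : ℂ → ℂ} (hB : IsFiniteBlaschkeOn B (sphere (0 : ℂ) 1))
    {z : ℂ} (hz : z ∈ sphere (0 : ℂ) 1) : B z ≠ 0 := by
  obtain ⟨n, c, a, hc, ha, h⟩ := hB
  rw [h hz]
  exact finBlaschke_ne_zero hc ha hz

theorem IsFiniteBlaschkeOn.mul {B C : ℂ → ℂ} {s : Set ℂ} (hB : IsFiniteBlaschkeOn B s)
    (hC : IsFiniteBlaschkeOn C s) : IsFiniteBlaschkeOn (fun z => B z * C z) s := by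
  obtain ⟨n, c, a, hc, ha, h⟩ := hB
  obtain ⟨m, d, b, hd, hb, h'⟩ := hC
  refine ⟨n + m, c * d, Fin.append a b, by simp [hc, hd], ?_, fun z hz => ?_⟩
  · intro k
    refine Fin.addCases (fun i => ?_) (fun i => ?_) k
    · simpa using ha i
    · simpa using hb i
  · simp only [h hz, h' hz, finBlaschke, Fin.prod_univ_add, Fin.append_left, Fin.append_right]
    ring

theorem IsFiniteBlaschkeOn.const {c : ℂ} (hc : ‖c‖ = 1) (s : Set ℂ) :
    IsFiniteBlaschkeOn (fun _ => c) s :=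
  ⟨0, c, Fin.elim0, hc, fun k => k.elim0, fun z _ => by simp [finBlaschke]⟩

/-- `u` agrees on the unit circle with a quotient of two finite Blaschke products. -/
def IsBlaschkeQuotient (u : ℂ → ℂ) : Prop :=
  ∃ B₁ B₂ : ℂ → ℂ, IsFiniteBlaschkeOn B₁ (sphere (0 : ℂ) 1) ∧
    IsFiniteBlaschkeOn B₂ (sphere (0 : ℂ) 1) ∧ ∀ z ∈ sphere (0 : ℂ) 1, u z = B₁ z / B₂ z

namespace IsBlaschkeQuotient

theorem congr {u v : ℂ → ℂ} (hu : IsBlaschkeQuotient u)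
    (h : ∀ z ∈ sphere (0 : ℂ) 1, v z = u z) : IsBlaschkeQuotient v := by
  obtain ⟨B, C, hB, hC, hu⟩ := hu
  exact ⟨B, C, hB, hC, fun z hz => (h z hz).trans (hu z hz)⟩

theorem of_isFiniteBlaschkeOn {B : ℂ → ℂ} (hB : IsFiniteBlaschkeOn B (sphere (0 : ℂ) 1)) :
    IsBlaschkeQuotient B :=
  ⟨B, fun _ => 1, hB, .const norm_one _, by simp⟩

theorem const {c : ℂ} (hc : ‖c‖ = 1) : IsBlaschkeQuotient (fun _ => c) :=
  of_isFiniteBlaschkeOn (.const hc _)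

theorem inv {u : ℂ → ℂ} (hu : IsBlaschkeQuotient u) : IsBlaschkeQuotient (fun z => (u z)⁻¹) := by
  obtain ⟨B, C, hB, hC, hu⟩ := hu
  exact ⟨C, B, hC, hB, fun z hz => by simp only [hu z hz, inv_div]⟩

theorem mul {u v : ℂ → ℂ} (hu : IsBlaschkeQuotient u) (hv : IsBlaschkeQuotient v) :
    IsBlaschkeQuotient (fun z => u z * v z) := by
  obtain ⟨B, C, hB, hC, hu⟩ := hu
  obtain ⟨B', C', hB', hC', hv⟩ := hv
  exact ⟨_, _, hB.mul hB', hC.mul hC', fun z hz => by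
    simp only [hu z hz, hv z hz, div_mul_div_comm]⟩

theorem pow {u : ℂ → ℂ} (hu : IsBlaschkeQuotient u) (n : ℕ) :
    IsBlaschkeQuotient (fun z => u z ^ n) := by
  induction n with
  | zero => simpa using const norm_one
  | succ n ih => simpa only [pow_succ] using ih.mul hu

theorem factor {a : ℂ} (ha : ‖a‖ < 1) :
    IsBlaschkeQuotient (fun z => (a - z) / (1 - (starRingEnd ℂ) a * z)) :=
  of_isFiniteBlaschkeOn ⟨1, 1, fun _ => a, norm_one, fun _ => ha, fun z _ => by simp [finBlaschke]⟩

theorem id : IsBlaschkeQuotient (fun z => z) :=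
  ((const (c := -1) (by simp)).mul (factor (a := 0) (by simp))).congr fun z _ => by simp

end IsBlaschkeQuotient

theorem isBlaschkeQuotient_sub_div_conj {a : ℂ} (ha : ‖a‖ ≠ 1) :
    IsBlaschkeQuotient (fun z => (z - a) / (starRingEnd ℂ) (z - a)) := by
  rcases lt_or_gt_of_ne ha with h | h
  · refine (((IsBlaschkeQuotient.const (c := -1) (by simp)).mul .id).mul (.factor h)).congr
      fun z hz => ?_
    have hz1 : ‖z‖ = 1 := by simpa using hz
    have hz0 : z ≠ 0 := fun h => by simp [h] at hz1
    have hd : (starRingEnd ℂ) (z - a) = (1 - (starRingEnd ℂ) a * z) / z := by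
      rw [map_sub, ← Complex.inv_eq_conj hz1]
      field_simp
    rw [hd, div_div_eq_mul_div]
    ring
  · have ha0 : a ≠ 0 := fun h0 => by simp [h0] at h; linarith
    have ha0' : (starRingEnd ℂ) a ≠ 0 := by simpa using ha0
    have hb : ‖((starRingEnd ℂ) a)⁻¹‖ < 1 := by
      rw [norm_inv, RCLike.norm_conj]
      exact inv_lt_one_of_one_lt₀ h
    have hc : ‖-(a / (starRingEnd ℂ) a)‖ = 1 := by
      rw [norm_neg, norm_div, RCLike.norm_conj, div_self (norm_ne_zero_iff.2 ha0)]
    refine (((IsBlaschkeQuotient.const hc).mul .id).mul (IsBlaschkeQuotient.factor hb).inv).congr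
      fun z hz => ?_
    have hz1 : ‖z‖ = 1 := by simpa using hz
    have hz0 : z ≠ 0 := fun h => by simp [h] at hz1
    have hd : (starRingEnd ℂ) (z - a) = (1 - (starRingEnd ℂ) a * z) / z := by
      rw [map_sub, ← Complex.inv_eq_conj hz1]
      field_simp
    have hne : 1 - (starRingEnd ℂ) a * z ≠ 0 := by
      intro h0
      have h1 : ‖(starRingEnd ℂ) a * z‖ = 1 := by rw [← sub_eq_zero.1 h0, norm_one]
      rw [norm_mul, hz1, RCLike.norm_conj, mul_one] at h1
      exact ha h1
    have e1 : ((starRingEnd ℂ) a)⁻¹ - z = (1 - (starRingEnd ℂ) a * z) / (starRingEnd ℂ) a := by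
      field_simp
    have e2 : 1 - (starRingEnd ℂ) ((starRingEnd ℂ) a)⁻¹ * z = (a - z) / a := by
      rw [map_inv₀, Complex.conj_conj]
      field_simp
    rw [hd, e1, e2, inv_div]
    field_simp
    ring

theorem isBlaschkeQuotient_eval_div_conj {P : Polynomial ℂ}
    (hP : ∀ z ∈ sphere (0 : ℂ) 1, P.eval z ≠ 0) :
    IsBlaschkeQuotient (fun z => P.eval z / (starRingEnd ℂ) (P.eval z)) := by
  have hP0 : P ≠ 0 := fun h => hP 1 (by simp) (by simp [h])
  have hroots : ∀ a ∈ P.roots, ‖a‖ ≠ 1 := fun a ha h =>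
    hP a (by simpa using h) (Polynomial.isRoot_of_mem_roots ha)
  have key : ∀ s : Multiset ℂ, (∀ a ∈ s, ‖a‖ ≠ 1) → IsBlaschkeQuotient (fun z =>
      (s.map fun a => z - a).prod / (starRingEnd ℂ) (s.map fun a => z - a).prod) := by
    intro s
    induction s using Multiset.induction_on with
    | empty => intro _; simpa using IsBlaschkeQuotient.const norm_one
    | cons a s ih =>
      intro h
      refine ((isBlaschkeQuotient_sub_div_conj (h a (by simp))).mul
        (ih fun b hb => h b (by simp [hb]))).congr fun z _ => ?_
      rw [Multiset.map_cons, Multiset.prod_cons, map_mul, div_mul_div_comm]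
  have hlc : P.leadingCoeff ≠ 0 := Polynomial.leadingCoeff_ne_zero.2 hP0
  have hc : ‖P.leadingCoeff / (starRingEnd ℂ) P.leadingCoeff‖ = 1 := by
    rw [norm_div, RCLike.norm_conj, div_self (norm_ne_zero_iff.2 hlc)]
  refine ((IsBlaschkeQuotient.const hc).mul (key P.roots hroots)).congr fun z _ => ?_
  have he : P.eval z = P.leadingCoeff * (P.roots.map fun a => z - a).prod :=
    (IsAlgClosed.splits P).eval_eq_prod_roots z
  rw [he, map_mul, div_mul_div_comm]

/-- `g` agrees on the unit circle with a Laurent polynomial. -/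
def IsLaurentOnCircle (g : ℂ → ℂ) : Prop :=
  ∃ (p : Polynomial ℂ) (N : ℕ), ∀ z ∈ sphere (0 : ℂ) 1, g z * z ^ N = p.eval z

theorem exists_isLaurentOnCircle_approx {f : ℂ → ℂ} (hf : ContinuousOn f (sphere (0 : ℂ) 1))
    {δ : ℝ} (hδ : 0 < δ) :
    ∃ g, IsLaurentOnCircle g ∧ ∀ z ∈ sphere (0 : ℂ) 1, ‖g z - f z‖ < δ := by
  have : CompactSpace (sphere (0 : ℂ) 1) := isCompact_iff_compactSpace.1 (isCompact_sphere _ _)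
  let F : C(sphere (0 : ℂ) 1, ℂ) := ⟨_, hf.domRestrict⟩
  have hF : F ∈ (polynomialFunctions (sphere (0 : ℂ) 1)).starClosure.topologicalClosure := by
    rw [polynomialFunctions.starClosure_topologicalClosure]
    trivial
  obtain ⟨G, hG, hGF⟩ := Metric.mem_closure_iff.1 hF δ hδ
  have key : ∃ g, IsLaurentOnCircle g ∧ ∀ z : sphere (0 : ℂ) 1, g z = G z := by
    rw [SetLike.mem_coe, polynomialFunctions.starClosure_eq_adjoin_X] at hG
    clear hGF
    induction hG using Algebra.adjoin_induction with
    | mem G hG =>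
      rcases hG with hG | hG
      · rw [Set.mem_singleton_iff] at hG
        subst hG
        exact ⟨fun z => z, ⟨Polynomial.X, 0, by simp⟩, fun z => by simp⟩
      · rw [Set.mem_star, Set.mem_singleton_iff] at hG
        refine ⟨fun z => z⁻¹, ⟨1, 1, fun z hz => ?_⟩, fun z => ?_⟩
        · have hz0 : z ≠ 0 := fun h => by simp [h] at hz
          simp [hz0]
        · rw [← star_star G, hG]
          simp [Complex.inv_eq_conj (norm_eq_of_mem_sphere z)]
    | algebraMap c => exact ⟨fun _ => c, ⟨Polynomial.C c, 0, by simp⟩, fun z => by simp⟩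
    | add G H _ _ hG hH =>
      obtain ⟨g, ⟨p, N, hp⟩, hg⟩ := hG
      obtain ⟨h, ⟨q, M, hq⟩, hh⟩ := hH
      refine ⟨fun z => g z + h z, ⟨p * Polynomial.X ^ M + q * Polynomial.X ^ N, N + M,
        fun z hz => ?_⟩, fun z => by simp [hg, hh]⟩
      simp only [Polynomial.eval_add, Polynomial.eval_mul, Polynomial.eval_pow, Polynomial.eval_X,
        ← hp z hz, ← hq z hz]
      ring
    | mul G H _ _ hG hH =>
      obtain ⟨g, ⟨p, N, hp⟩, hg⟩ := hG
      obtain ⟨h, ⟨q, M, hq⟩, hh⟩ := hH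
      refine ⟨fun z => g z * h z, ⟨p * q, N + M, fun z hz => ?_⟩, fun z => by simp [hg, hh]⟩
      simp only [Polynomial.eval_mul, ← hp z hz, ← hq z hz]
      ring
  obtain ⟨g, hg, hgG⟩ := key
  refine ⟨g, hg, fun z hz => ?_⟩
  rw [hgG ⟨z, hz⟩, ← dist_eq_norm, dist_comm]
  exact (ContinuousMap.dist_apply_le_dist (f := F) (g := G) ⟨z, hz⟩).trans_lt hGF

/-- The disc automorphisms `w ↦ (g + w) / (1 + conj g * w)`, for fixed `w` on the unit circle. -/
theorem IsLaurentOnCircle.isBlaschkeQuotient {g : ℂ → ℂ} (hg : IsLaurentOnCircle g)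
    (hg1 : ∀ z ∈ sphere (0 : ℂ) 1, ‖g z‖ < 1) {w : ℂ} (hw : ‖w‖ = 1) :
    IsBlaschkeQuotient (fun z => (g z + w) / (1 + (starRingEnd ℂ) (g z) * w)) := by
  obtain ⟨p, N, h⟩ := hg
  have hP : ∀ z ∈ sphere (0 : ℂ) 1,
      (p + Polynomial.C w * Polynomial.X ^ N).eval z = (g z + w) * z ^ N := fun z hz => by
    simp [← h z hz, add_mul]
  have hw0 : w ≠ 0 := fun h => by simp [h] at hw
  refine (((IsBlaschkeQuotient.const hw).inv.mul (IsBlaschkeQuotient.id.pow (2 * N)).inv).mul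
    (isBlaschkeQuotient_eval_div_conj (P := p + Polynomial.C w * Polynomial.X ^ N)
      fun z hz => ?_)).congr fun z hz => ?_
  · rw [hP z hz]
    have hz0 : z ≠ 0 := fun h => by simp [h] at hz
    refine mul_ne_zero (fun h0 => ?_) (pow_ne_zero _ hz0)
    have := hg1 z hz
    rw [eq_neg_of_add_eq_zero_left h0, norm_neg, hw] at this
    exact lt_irrefl _ this
  · have hz1 : ‖z‖ = 1 := by simpa using hz
    have hz0 : z ≠ 0 := fun h => by simp [h] at hz1
    have hd : 1 + (starRingEnd ℂ) (g z) * w = w * (starRingEnd ℂ) (g z + w) := by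
      rw [map_add, ← Complex.inv_eq_conj hw]
      field_simp
      ring
    rw [hP z hz, map_mul, map_pow, ← Complex.inv_eq_conj hz1, hd]
    simp only [div_eq_mul_inv, mul_inv, inv_pow, inv_inv]
    field_simp
    ring

theorem sum_inv_one_sub_mul_primitiveRoot {M : ℕ} (hM : 0 < M) {ω : ℂ}
    (hω : IsPrimitiveRoot ω M) {x : ℂ} (hx : ‖x‖ < 1) :
    ∑ j ∈ Finset.range M, ω ^ j / (1 - x * ω ^ j) = M * (x ^ (M - 1) / (1 - x ^ M)) := by
  have hxM : 1 - x ^ M ≠ 0 := fun h => by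
    have h1 : ‖x‖ ^ M = 1 := by rw [← norm_pow, ← sub_eq_zero.1 h, norm_one]
    exact (pow_lt_one₀ (norm_nonneg x) hx hM.ne').ne h1
  have hterm : ∀ j, ω ^ j / (1 - x * ω ^ j) =
      (∑ k ∈ Finset.range M, x ^ k * (ω ^ (k + 1)) ^ j) / (1 - x ^ M) := by
    intro j
    have hgeom := mul_neg_geom_sum (x * ω ^ j) M
    have hpow : (x * ω ^ j) ^ M = x ^ M := by
      rw [mul_pow, ← pow_mul, mul_comm j M, pow_mul, hω.pow_eq_one, one_pow, mul_one]
    rw [hpow] at hgeom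
    have hne : 1 - x * ω ^ j ≠ 0 := fun h => hxM (by rw [← hgeom, h, zero_mul])
    rw [div_eq_div_iff hne hxM, ← hgeom, mul_left_comm, mul_comm _ (1 - x * ω ^ j),
      Finset.mul_sum]
    congr 1
    refine Finset.sum_congr rfl fun k _ => ?_
    ring
  rw [Finset.sum_congr rfl fun j _ => hterm j, ← Finset.sum_div, Finset.sum_comm, ← mul_div_assoc]
  congr 1
  rw [Finset.sum_eq_single (M - 1)]
  · rw [Nat.sub_add_cancel hM, hω.pow_eq_one]
    simp [mul_comm]
  · intro k hk hkM
    rw [Finset.mem_range] at hk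
    rw [← Finset.mul_sum]
    have hne : ω ^ (k + 1) ≠ 1 := hω.pow_ne_one_of_pos_of_lt (by omega) (by omega)
    rw [geom_sum_eq hne, ← pow_mul, mul_comm (k + 1), pow_mul, hω.pow_eq_one]
    simp
  · intro h
    exact absurd (Finset.mem_range.2 (by omega)) h

/-- The mean of a disc automorphism over the roots of unity is close to its value at `0`. -/
theorem norm_mean_automorphism_sub_le {M : ℕ} (hM : 0 < M) {ω : ℂ} (hω : IsPrimitiveRoot ω M)
    {w : ℂ} {r : ℝ} (hr : r < 1) (hw : ‖w‖ ≤ r) :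
    ‖∑ j ∈ Finset.range M, ((1 / M : ℝ) : ℂ) * ((w + ω ^ j) / (1 + (starRingEnd ℂ) w * ω ^ j)) - w‖
      ≤ r ^ (M - 1) / (1 - r) := by
  have hω1 : ‖ω‖ = 1 := hω.norm'_eq_one hM.ne'
  have hr0 : 0 ≤ r := (norm_nonneg w).trans hw
  have hM0 : (M : ℂ) ≠ 0 := by exact_mod_cast hM.ne'
  set x : ℂ := -(starRingEnd ℂ) w with hx
  have hxw : ‖x‖ = ‖w‖ := by rw [hx, norm_neg, RCLike.norm_conj]
  have hx1 : ‖x‖ < 1 := by rw [hxw]; linarith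
  have hterm : ∀ j, (w + ω ^ j) / (1 + (starRingEnd ℂ) w * ω ^ j) =
      w + (1 + w * x) * (ω ^ j / (1 - x * ω ^ j)) := by
    intro j
    have hne : 1 - x * ω ^ j ≠ 0 := fun h => by
      have h1 : ‖x * ω ^ j‖ = 1 := by rw [← sub_eq_zero.1 h, norm_one]
      rw [norm_mul, norm_pow, hω1, one_pow, mul_one] at h1
      exact hx1.ne h1
    have : 1 + (starRingEnd ℂ) w * ω ^ j = 1 - x * ω ^ j := by rw [hx]; ring
    rw [this, ← mul_div_assoc, ← sub_eq_iff_eq_add', div_sub' hne]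
    congr 1
    ring
  have hsum : ∑ j ∈ Finset.range M,
      ((1 / M : ℝ) : ℂ) * ((w + ω ^ j) / (1 + (starRingEnd ℂ) w * ω ^ j)) - w =
      (1 + w * x) * (x ^ (M - 1) / (1 - x ^ M)) := by
    rw [← Finset.mul_sum, Finset.sum_congr rfl fun j _ => hterm j, Finset.sum_add_distrib,
      ← Finset.mul_sum, sum_inv_one_sub_mul_primitiveRoot hM hω hx1]
    simp only [Finset.sum_const, Finset.card_range, nsmul_eq_mul]
    push_cast
    field_simp
    ring
  have hfac : ‖1 + w * x‖ ≤ 1 := by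
    have : 1 + w * x = ((1 - ‖w‖ ^ 2 : ℝ) : ℂ) := by
      rw [hx, mul_neg, Complex.mul_conj, Complex.normSq_eq_norm_sq]
      push_cast
      ring
    rw [this, Complex.norm_real, Real.norm_eq_abs, abs_le]
    constructor <;> nlinarith [norm_nonneg w]
  have hden : 1 - r ≤ ‖1 - x ^ M‖ := by
    have h1 : ‖x ^ M‖ ≤ r := by
      rw [norm_pow]
      exact (pow_le_of_le_one (norm_nonneg _) hx1.le hM.ne').trans (hxw ▸ hw)
    have h2 := norm_sub_norm_le (1 : ℂ) (x ^ M)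
    rw [norm_one] at h2
    linarith
  rw [hsum, norm_mul, norm_div, norm_pow, hxw]
  calc ‖1 + w * x‖ * (‖w‖ ^ (M - 1) / ‖1 - x ^ M‖)
      ≤ 1 * (r ^ (M - 1) / (1 - r)) := by gcongr
    _ = _ := one_mul _

/-- Every function in the closed unit ball of `C(𝕋)` can be uniformly approximated by convex
combinations of quotients of finite Blaschke products. -/
theorem convex_combination_quotients_finite_blaschke (f : ℂ → ℂ)
    (hf : ContinuousOn f (sphere (0:ℂ) 1))
    (hb : ∀ ζ ∈ sphere (0:ℂ) 1, ‖f ζ‖ ≤ 1)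
    (ε : ℝ) (hε : 0 < ε) :
    ∃ (n : ℕ) (l : Fin n → ℝ) (B₁ B₂ : Fin n → ℂ → ℂ),
      (∀ i, 0 ≤ l i) ∧ (∑ i, l i = 1) ∧
      (∀ i, IsFiniteBlaschkeOn (B₁ i) (sphere (0:ℂ) 1)) ∧
      (∀ i, IsFiniteBlaschkeOn (B₂ i) (sphere (0:ℂ) 1)) ∧
      (∀ i, ∀ ζ ∈ sphere (0:ℂ) 1, B₂ i ζ ≠ 0) ∧
      ∀ ζ ∈ sphere (0:ℂ) 1, ‖(∑ i, (l i : ℂ) * (B₁ i ζ / B₂ i ζ)) - f ζ‖ < ε := by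
  set δ : ℝ := min (ε / 4) (1 / 2) with hδ
  have hδ0 : 0 < δ := by positivity
  have hδε : δ ≤ ε / 4 := min_le_left _ _
  have hδ1 : δ ≤ 1 / 2 := min_le_right _ _
  obtain ⟨g, hg, hgf⟩ := exists_isLaurentOnCircle_approx
    (f := fun z => ((1 - δ : ℝ) : ℂ) * f z) (continuousOn_const.mul hf) (half_pos hδ0)
  have hgr : ∀ z ∈ sphere (0 : ℂ) 1, ‖g z‖ ≤ 1 - δ / 2 := by
    intro z hz
    have h1 : ‖((1 - δ : ℝ) : ℂ) * f z‖ ≤ 1 - δ := by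
      rw [norm_mul, Complex.norm_real, Real.norm_of_nonneg (by linarith)]
      exact mul_le_of_le_one_right (by linarith) (hb z hz)
    have h2 := norm_sub_norm_le (g z) (((1 - δ : ℝ) : ℂ) * f z)
    linarith [hgf z hz]
  have hgf' : ∀ z ∈ sphere (0 : ℂ) 1, ‖g z - f z‖ < ε / 2 := by
    intro z hz
    have h1 : ‖(δ : ℂ) * f z‖ ≤ δ := by
      rw [norm_mul, Complex.norm_real, Real.norm_of_nonneg hδ0.le]
      exact mul_le_of_le_one_right hδ0.le (hb z hz)
    have h2 : g z - f z = (g z - ((1 - δ : ℝ) : ℂ) * f z) - (δ : ℂ) * f z := by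
      push_cast
      ring
    have h3 := norm_sub_le (g z - ((1 - δ : ℝ) : ℂ) * f z) ((δ : ℂ) * f z)
    rw [h2]
    linarith [hgf z hz]
  obtain ⟨m, hm⟩ := exists_pow_lt_of_lt_one (show 0 < ε / 2 * (δ / 2) by positivity)
    (show 1 - δ / 2 < 1 by linarith)
  have hω := Complex.isPrimitiveRoot_exp (m + 1) m.succ_ne_zero
  set ω := Complex.exp (2 * Real.pi * I / ((m + 1 : ℕ) : ℂ)) with hωdef
  have hω1 : ‖ω‖ = 1 := hω.norm'_eq_one m.succ_ne_zero
  have hquot : ∀ i : Fin (m + 1), IsBlaschkeQuotient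
      (fun z => (g z + ω ^ (i : ℕ)) / (1 + (starRingEnd ℂ) (g z) * ω ^ (i : ℕ))) := fun i =>
    hg.isBlaschkeQuotient (fun z hz => (hgr z hz).trans_lt (by linarith))
      (by rw [norm_pow, hω1, one_pow])
  choose B₁ B₂ hB₁ hB₂ hB using hquot
  refine ⟨m + 1, fun _ => 1 / ((m + 1 : ℕ) : ℝ), B₁, B₂, fun i => by positivity, ?_, hB₁, hB₂,
    fun i z hz => (hB₂ i).ne_zero hz, fun z hz => ?_⟩
  · rw [Finset.sum_const, Finset.card_univ, Fintype.card_fin, nsmul_eq_mul]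
    exact mul_one_div_cancel (by positivity)
  · have hmean := norm_mean_automorphism_sub_le m.succ_pos hω
      (show 1 - δ / 2 < 1 by linarith) (hgr z hz)
    rw [Finset.sum_range] at hmean
    simp only [hB _ z hz] at hmean
    have hlt : (1 - δ / 2) ^ (m + 1 - 1) / (1 - (1 - δ / 2)) < ε / 2 := by
      rw [Nat.add_sub_cancel, sub_sub_cancel, div_lt_iff₀ (half_pos hδ0)]
      exact hm
    calc _ ≤ _ := norm_sub_le_norm_sub_add_norm_sub _ (g z) _
      _ < ε / 2 + ε / 2 := add_lt_add (hmean.trans_lt hlt) (hgf' z hz)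
      _ = ε := add_halves ε
end

section
/- (Frostman) Let φ be an inner function on the open unit disc 𝔻, and fix 0 < ρ < 1. For w ∈ 𝔻, let φ_w(z) = (w − φ(z))/(1 − conj(w)·φ(z)). Then the set of θ ∈ [0, 2π] for which φ_{ρe^{iθ}} is not a Blaschke product has Lebesgue measure zero. -/
open Complex Metric Set Filter MeasureTheory
open scoped Topology Real

/-- A (possibly infinite) Blaschke product
`c z^m ∏ᵢ (|aᵢ|/aᵢ)·(aᵢ - z)/(1 - conj aᵢ · z)`. -/
noncomputable def blaschkeProd (m : ℕ) (c : ℂ) {ι : Type} (a : ι → ℂ) : ℂ → ℂ :=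
  fun z => c * z ^ m *
    ∏' i, ((‖a i‖ : ℂ) / a i) * ((a i - z) / (1 - (starRingEnd ℂ) (a i) * z))

/-- `f` is a Blaschke product on the set `s`: it agrees there with
`c z^m ∏ᵢ (|aᵢ|/aᵢ)(aᵢ - z)/(1 - conj aᵢ z)` where `|c| = 1`, the `aᵢ` form a (finite or
countable) family of nonzero points of the open unit disc satisfying the Blaschke condition
`∑ᵢ (1 - |aᵢ|) < ∞`. -/
def IsBlaschkeProductOn (f : ℂ → ℂ) (s : Set ℂ) : Prop :=
  ∃ (m : ℕ) (c : ℂ) (ι : Type) (_ : Countable ι) (a : ι → ℂ),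
    ‖c‖ = 1 ∧ (∀ i, a i ≠ 0 ∧ ‖a i‖ < 1) ∧
    Summable (fun i => 1 - ‖a i‖) ∧
    Set.EqOn f (blaschkeProd m c a) s

/-- `φ` is an inner function: a bounded holomorphic function on the open unit disc whose radial
boundary values have modulus one almost everywhere. -/
def IsInner (φ : ℂ → ℂ) : Prop :=
  DifferentiableOn ℂ φ (ball (0:ℂ) 1) ∧
  (∃ C : ℝ, ∀ z ∈ ball (0:ℂ) 1, ‖φ z‖ ≤ C) ∧
  ∀ᵐ (θ : ℝ) ∂(volume.restrict (Set.Ioc (0:ℝ) (2*π))),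
    ∃ L : ℂ, ‖L‖ = 1 ∧
      Tendsto (fun r : ℝ => φ ((r : ℂ) * Complex.exp ((θ : ℂ) * Complex.I)))
        (𝓝[<] (1:ℝ)) (𝓝 L)


/-- The disc automorphism exchanging `0` and `a`. -/
noncomputable def moebius (a z : ℂ) : ℂ := (a - z) / (1 - (starRingEnd ℂ) a * z)

lemma one_sub_conj_mul_ne_zero {a z : ℂ} (ha : ‖a‖ < 1) (hz : ‖z‖ ≤ 1) :
    1 - (starRingEnd ℂ) a * z ≠ 0 := by
  intro h
  have h1 : ‖(starRingEnd ℂ) a * z‖ = 1 := by rw [← sub_eq_zero.1 h, norm_one]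
  rw [norm_mul, RCLike.norm_conj] at h1
  nlinarith [norm_nonneg a, norm_nonneg z]

lemma sq_norm_one_sub_conj_mul_sub (a z : ℂ) :
    ‖1 - (starRingEnd ℂ) a * z‖ ^ 2 - ‖a - z‖ ^ 2 = (1 - ‖a‖ ^ 2) * (1 - ‖z‖ ^ 2) := by
  simp only [Complex.sq_norm, Complex.normSq_apply, sub_re, sub_im, mul_re, mul_im, conj_re,
    conj_im, one_re, one_im]
  ring

lemma norm_moebius_le_one {a z : ℂ} (ha : ‖a‖ < 1) (hz : ‖z‖ ≤ 1) : ‖moebius a z‖ ≤ 1 := by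
  have h := sq_norm_one_sub_conj_mul_sub a z
  rw [moebius, norm_div]
  refine div_le_one_of_le₀ (le_of_sq_le_sq ?_ (norm_nonneg _)) (norm_nonneg _)
  have h1 : 0 ≤ 1 - ‖a‖ ^ 2 := by nlinarith [norm_nonneg a]
  have h2 : 0 ≤ 1 - ‖z‖ ^ 2 := by nlinarith [norm_nonneg z]
  nlinarith [mul_nonneg h1 h2]

lemma norm_moebius_lt_one {a z : ℂ} (ha : ‖a‖ < 1) (hz : ‖z‖ < 1) : ‖moebius a z‖ < 1 := by
  have h := sq_norm_one_sub_conj_mul_sub a z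
  rw [moebius, norm_div, div_lt_one (norm_pos_iff.2 (one_sub_conj_mul_ne_zero ha hz.le))]
  refine lt_of_pow_lt_pow_left₀ 2 (norm_nonneg _) ?_
  have h1 : 0 < 1 - ‖a‖ ^ 2 := by nlinarith [norm_nonneg a]
  have h2 : 0 < 1 - ‖z‖ ^ 2 := by nlinarith [norm_nonneg z]
  nlinarith [mul_pos h1 h2]

lemma moebius_moebius {a z : ℂ} (ha : ‖a‖ < 1) (hz : ‖z‖ < 1) : moebius a (moebius a z) = z := by
  have h1 := one_sub_conj_mul_ne_zero ha hz.le
  have h2 := one_sub_conj_mul_ne_zero ha (norm_moebius_le_one ha hz.le)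
  have h3 : moebius a z * (1 - (starRingEnd ℂ) a * z) = a - z := div_mul_cancel₀ _ h1
  rw [moebius, div_eq_iff h2]
  have h4 : (a - moebius a z) * (1 - (starRingEnd ℂ) a * z) =
      z * (1 - (starRingEnd ℂ) a * moebius a z) * (1 - (starRingEnd ℂ) a * z) := by
    linear_combination (-1 + z * (starRingEnd ℂ) a) * h3
  exact mul_right_cancel₀ h1 h4

@[simp] lemma moebius_self (a : ℂ) : moebius a a = 0 := by simp [moebius]

@[simp] lemma moebius_apply_zero (a : ℂ) : moebius a 0 = a := by simp [moebius]

lemma moebius_ne_zero {a z : ℂ} (ha : ‖a‖ < 1) (hz : ‖z‖ < 1) (h : z ≠ a) : moebius a z ≠ 0 :=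
  div_ne_zero (sub_ne_zero.2 h.symm) (one_sub_conj_mul_ne_zero ha hz.le)

lemma differentiableOn_moebius {a : ℂ} (ha : ‖a‖ < 1) :
    DifferentiableOn ℂ (moebius a) (ball 0 1) := by
  unfold moebius
  refine DifferentiableOn.div (by fun_prop) (by fun_prop) fun z hz => ?_
  exact one_sub_conj_mul_ne_zero ha (mem_ball_zero_iff.1 hz).le

/-- **Schwarz–Pick**, at a zero of the function. -/
lemma norm_le_norm_moebius {F : ℂ → ℂ} (hF : DifferentiableOn ℂ F (ball 0 1))
    (hF1 : ∀ z ∈ ball (0 : ℂ) 1, ‖F z‖ ≤ 1) {a z : ℂ} (ha : ‖a‖ < 1) (hz : ‖z‖ < 1)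
    (hFa : F a = 0) : ‖F z‖ ≤ ‖moebius a z‖ := by
  have hm : MapsTo (moebius a) (ball 0 1) (ball 0 1) := fun w hw =>
    mem_ball_zero_iff.2 (norm_moebius_lt_one ha (mem_ball_zero_iff.1 hw))
  have h := Complex.norm_le_norm_of_mapsTo_ball (f := F ∘ moebius a) (R := 1)
    (z := moebius a z) (hF.comp (differentiableOn_moebius ha) hm)
    (fun w hw => mem_closedBall_zero_iff.2 (hF1 _ (hm hw))) (by simp [hFa])
    (norm_moebius_lt_one ha hz)
  simpa [moebius_moebius ha hz] using h

/-- A zero of a function bounded by one on the disc can be divided out without increasing the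
bound. -/
lemma exists_eq_moebius_mul {F : ℂ → ℂ} (hF : DifferentiableOn ℂ F (ball 0 1))
    (hF1 : ∀ z ∈ ball (0 : ℂ) 1, ‖F z‖ ≤ 1) {a : ℂ} (ha : ‖a‖ < 1) (hFa : F a = 0) :
    ∃ H : ℂ → ℂ, DifferentiableOn ℂ H (ball 0 1) ∧ (∀ z ∈ ball (0 : ℂ) 1, ‖H z‖ ≤ 1) ∧
      ∀ z ∈ ball (0 : ℂ) 1, F z = moebius a z * H z := by
  have hd : DifferentiableOn ℂ (dslope F a) (ball 0 1) :=
    (Complex.differentiableOn_dslope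
      (isOpen_ball.mem_nhds (mem_ball_zero_iff.2 ha))).2 hF
  have hH : DifferentiableOn ℂ (fun z => -dslope F a z * (1 - (starRingEnd ℂ) a * z))
    (ball 0 1) := by fun_prop
  have heq : ∀ z ∈ ball (0 : ℂ) 1,
      F z = moebius a z * (-dslope F a z * (1 - (starRingEnd ℂ) a * z)) := by
    intro z hz
    have h1 := one_sub_conj_mul_ne_zero ha (mem_ball_zero_iff.1 hz).le
    have h2 := sub_smul_dslope F a z
    rw [smul_eq_mul, hFa, sub_zero] at h2
    rw [← h2, moebius, div_mul_eq_mul_div, eq_div_iff h1]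
    ring
  refine ⟨_, hH, ?_, heq⟩
  have hne : ∀ z ∈ ball (0 : ℂ) 1, z ≠ a →
      ‖-dslope F a z * (1 - (starRingEnd ℂ) a * z)‖ ≤ 1 := by
    intro z hz hza
    have hz' := mem_ball_zero_iff.1 hz
    have h1 := norm_le_norm_moebius hF hF1 ha hz' hFa
    rw [heq z hz, norm_mul] at h1
    exact le_of_mul_le_mul_left (by simpa using h1) (norm_pos_iff.2 (moebius_ne_zero ha hz' hza))
  intro z hz
  by_cases hza : z = a
  · subst hza
    have hc := (hH.continuousOn.continuousAt (isOpen_ball.mem_nhds hz)).norm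
    refine le_of_tendsto (hc.mono_left (nhdsWithin_le_nhds (s := {z}ᶜ))) ?_
    filter_upwards [self_mem_nhdsWithin, nhdsWithin_le_nhds (isOpen_ball.mem_nhds hz)]
      with w hw hwb using hne w hwb hw
  · exact hne z hz hza

lemma analyticAt_of_ball {F : ℂ → ℂ} (hF : DifferentiableOn ℂ F (ball 0 1)) {a : ℂ}
    (ha : ‖a‖ < 1) : AnalyticAt ℂ F a :=
  hF.analyticAt (isOpen_ball.mem_nhds (mem_ball_zero_iff.2 ha))

lemma analyticOrderAt_moebius {a : ℂ} (ha : ‖a‖ < 1) : analyticOrderAt (moebius a) a = 1 := by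
  have hne := one_sub_conj_mul_ne_zero ha ha.le
  refine ((analyticAt_of_ball (differentiableOn_moebius ha) ha).analyticOrderAt_eq_natCast
    (n := 1)).2 ⟨fun z => -(1 - (starRingEnd ℂ) a * z)⁻¹, ?_, ?_, ?_⟩
  · have h : AnalyticAt ℂ (fun z => 1 - (starRingEnd ℂ) a * z) a := by fun_prop
    exact (h.inv hne).neg
  · simpa using hne
  · refine Eventually.of_forall fun z => ?_
    rw [moebius, pow_one, smul_eq_mul, div_eq_mul_inv]
    ring

lemma exists_eq_moebius_pow_mul {F : ℂ → ℂ} (hF : DifferentiableOn ℂ F (ball 0 1))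
    (hF1 : ∀ z ∈ ball (0 : ℂ) 1, ‖F z‖ ≤ 1) {a : ℂ} (ha : ‖a‖ < 1)
    {n : ℕ} (hn : analyticOrderAt F a = n) :
    ∃ H : ℂ → ℂ, DifferentiableOn ℂ H (ball 0 1) ∧ (∀ z ∈ ball (0 : ℂ) 1, ‖H z‖ ≤ 1) ∧
      H a ≠ 0 ∧ ∀ z ∈ ball (0 : ℂ) 1, F z = moebius a z ^ n * H z := by
  induction n generalizing F with
  | zero =>
    refine ⟨F, hF, hF1, ?_, by simp⟩
    exact (analyticAt_of_ball hF ha).analyticOrderAt_eq_zero.1 (by simpa using hn)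
  | succ n ih =>
    have hFa : F a = 0 := by
      refine (analyticAt_of_ball hF ha).analyticOrderAt_ne_zero.1 ?_
      rw [hn]; simp
    obtain ⟨H, hH, hH1, hFH⟩ := exists_eq_moebius_mul hF hF1 ha hFa
    have hev : F =ᶠ[𝓝 a] moebius a * H := by
      filter_upwards [isOpen_ball.mem_nhds (mem_ball_zero_iff.2 ha)] with z hz using hFH z hz
    have hord : analyticOrderAt H a = n := by
      rw [analyticOrderAt_congr hev, analyticOrderAt_mul
        (analyticAt_of_ball (differentiableOn_moebius ha) ha) (analyticAt_of_ball hH ha),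
        analyticOrderAt_moebius ha] at hn
      generalize analyticOrderAt H a = m at hn
      induction m using ENat.recTopCoe with
      | top => simp at hn; exact absurd hn.symm (ENat.natCast_ne_top (n + 1))
      | coe m => norm_cast at hn ⊢; omega
    obtain ⟨K, hK, hK1, hKa, hHK⟩ := ih hH hH1 hord
    exact ⟨K, hK, hK1, hKa, fun z hz => by rw [hFH z hz, hHK z hz, pow_succ']; ring⟩

lemma analyticOrderAt_ne_top_of_apply_zero_ne_zero {g : ℂ → ℂ}
    (hg : DifferentiableOn ℂ g (ball 0 1)) (hg0 : g 0 ≠ 0) {a : ℂ} (ha : ‖a‖ < 1) :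
    analyticOrderAt g a ≠ ⊤ := by
  intro h
  exact hg0 ((hg.analyticOnNhd isOpen_ball).eqOn_zero_of_preconnected_of_eventuallyEq_zero
    (convex_ball 0 1).isPreconnected (mem_ball_zero_iff.2 ha) (analyticOrderAt_eq_top.1 h)
    (mem_ball_self one_pos))

lemma finite_zeros_closedBall {g : ℂ → ℂ} (hg : DifferentiableOn ℂ g (ball 0 1)) (hg0 : g 0 ≠ 0)
    {r : ℝ} (hr : r < 1) : {z | z ∈ closedBall (0 : ℂ) r ∧ g z = 0}.Finite := by
  by_contra hinf
  obtain ⟨x, hx, hacc⟩ := Set.Infinite.exists_accPt_of_subset_isCompact hinf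
    (isCompact_closedBall (0 : ℂ) r) (fun z hz => hz.1)
  refine hg0 ((hg.analyticOnNhd isOpen_ball).eqOn_zero_of_preconnected_of_frequently_eq_zero
    (convex_ball 0 1).isPreconnected (closedBall_subset_ball hr hx) ?_ (mem_ball_self one_pos))
  exact (accPt_iff_frequently_nhdsNE.1 hacc).mono fun z hz => hz.2

/-- The zeros of `g` in the open unit disc. -/
abbrev DiscZero (g : ℂ → ℂ) : Type := {a : ℂ // ‖a‖ < 1 ∧ g a = 0}

/-- The zeros of `g` in the open unit disc, repeated according to multiplicity. -/
abbrev DiscZeroMult (g : ℂ → ℂ) : Type := Σ a : DiscZero g, Fin (analyticOrderNatAt g a)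

/-- The normalised Blaschke factor with zero `a`. -/
noncomputable def blaschkeFactor (a z : ℂ) : ℂ := ((‖a‖ : ℂ) / a) * moebius a z

lemma norm_norm_div_self {a : ℂ} (ha : a ≠ 0) : ‖(‖a‖ : ℂ) / a‖ = 1 := by
  simp [ha]

lemma norm_blaschkeFactor_le_one {a z : ℂ} (ha : ‖a‖ < 1) (hz : ‖z‖ ≤ 1) :
    ‖blaschkeFactor a z‖ ≤ 1 := by
  rw [blaschkeFactor, norm_mul]
  refine mul_le_one₀ ?_ (norm_nonneg _) (norm_moebius_le_one ha hz)
  by_cases h : a = 0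
  · simp [h]
  · exact (norm_norm_div_self h).le

lemma blaschkeFactor_apply_zero {a : ℂ} (ha : a ≠ 0) : blaschkeFactor a 0 = ‖a‖ := by
  simp [blaschkeFactor, ha]

lemma differentiableOn_blaschkeFactor {a : ℂ} (ha : ‖a‖ < 1) :
    DifferentiableOn ℂ (blaschkeFactor a) (ball 0 1) :=
  (differentiableOn_moebius ha).const_mul _

lemma exists_eq_prod_moebius_pow_mul {g : ℂ → ℂ} (hg : DifferentiableOn ℂ g (ball 0 1))
    (hg1 : ∀ z ∈ ball (0 : ℂ) 1, ‖g z‖ ≤ 1) (hg0 : g 0 ≠ 0) (T : Finset (DiscZero g)) :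
    ∃ h : ℂ → ℂ, DifferentiableOn ℂ h (ball 0 1) ∧ (∀ z ∈ ball (0 : ℂ) 1, ‖h z‖ ≤ 1) ∧
      (∀ a ∈ T, h a ≠ 0) ∧ ∀ z ∈ ball (0 : ℂ) 1,
        g z = (∏ a ∈ T, moebius a z ^ analyticOrderNatAt g a) * h z := by
  classical
  induction T using Finset.induction_on with
  | empty => exact ⟨g, hg, hg1, by simp, by simp⟩
  | insert a T haT ih =>
    obtain ⟨h, hh, hh1, hhT, hgh⟩ := ih
    have ha := a.2.1
    have hord : analyticOrderAt h a = analyticOrderNatAt g a := by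
      rw [Nat.cast_analyticOrderNatAt (analyticOrderAt_ne_top_of_apply_zero_ne_zero hg hg0 ha)]
      have hP : AnalyticAt ℂ (fun z => ∏ c ∈ T, moebius c z ^ analyticOrderNatAt g c) a :=
        Finset.analyticAt_fun_prod _ fun c _ =>
          (analyticAt_of_ball (differentiableOn_moebius c.2.1) ha).fun_pow _
      have hev : g =ᶠ[𝓝 (a : ℂ)]
          (fun z => ∏ c ∈ T, moebius c z ^ analyticOrderNatAt g c) * h := by
        filter_upwards [isOpen_ball.mem_nhds (mem_ball_zero_iff.2 ha)] with z hz using hgh z hz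
      rw [analyticOrderAt_congr hev, analyticOrderAt_mul hP (analyticAt_of_ball hh ha),
        hP.analyticOrderAt_eq_zero.2, zero_add]
      refine Finset.prod_ne_zero_iff.2 fun c hc => pow_ne_zero _ (moebius_ne_zero c.2.1 ha ?_)
      rintro hca
      exact haT ((Subtype.ext hca) ▸ hc)
    obtain ⟨k, hk, hk1, hka, hhk⟩ := exists_eq_moebius_pow_mul hh hh1 ha hord
    refine ⟨k, hk, hk1, fun c hc => ?_, fun z hz => ?_⟩
    · rcases Finset.mem_insert.1 hc with rfl | hc
      · exact hka
      · have := hhT c hc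
        rw [hhk c (mem_ball_zero_iff.2 c.2.1)] at this
        exact right_ne_zero_of_mul this
    · rw [hgh z hz, hhk z hz, Finset.prod_insert haT]
      ring

lemma discZero_ne_zero {g : ℂ → ℂ} (hg0 : g 0 ≠ 0) (a : DiscZero g) : (a : ℂ) ≠ 0 := by
  intro h
  have h2 := a.2.2
  rw [h] at h2
  exact hg0 h2

lemma exists_eq_prod_blaschkeFactor_mul_of_ne_zero {g : ℂ → ℂ}
    (hg : DifferentiableOn ℂ g (ball 0 1))
    (hg1 : ∀ z ∈ ball (0 : ℂ) 1, ‖g z‖ ≤ 1) (hg0 : g 0 ≠ 0) (T : Finset (DiscZero g)) :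
    ∃ h : ℂ → ℂ, DifferentiableOn ℂ h (ball 0 1) ∧ (∀ z ∈ ball (0 : ℂ) 1, ‖h z‖ ≤ 1) ∧
      (∀ a ∈ T, h a ≠ 0) ∧ ∀ z ∈ ball (0 : ℂ) 1,
        g z = (∏ i ∈ T.sigma (fun a => (Finset.univ : Finset (Fin (analyticOrderNatAt g a)))),
          blaschkeFactor i.1 z) * h z := by
  obtain ⟨h, hh, hh1, hhT, hgh⟩ := exists_eq_prod_moebius_pow_mul hg hg1 hg0 T
  set u : ℂ := ∏ a ∈ T, ((‖(a : ℂ)‖ : ℂ) / a) ^ analyticOrderNatAt g a with hu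
  have hu1 : ‖u‖ = 1 := by
    rw [hu, norm_prod]
    exact Finset.prod_eq_one fun a _ => by
      rw [norm_pow, norm_norm_div_self (discZero_ne_zero hg0 a), one_pow]
  have hu0 : u ≠ 0 := norm_ne_zero_iff.1 (by rw [hu1]; exact one_ne_zero)
  refine ⟨fun z => u⁻¹ * h z, hh.const_mul _, fun z hz => ?_, fun a ha => ?_, fun z hz => ?_⟩
  · rw [norm_mul, norm_inv, hu1]
    simpa using hh1 z hz
  · exact mul_ne_zero (inv_ne_zero hu0) (hhT a ha)
  · rw [hgh z hz, Finset.prod_sigma]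
    simp only [Finset.prod_const, Finset.card_univ, Fintype.card_fin, blaschkeFactor, mul_pow,
      Finset.prod_mul_distrib]
    rw [← hu]
    field_simp

lemma exists_eq_prod_blaschkeFactor_mul {g : ℂ → ℂ} (hg : DifferentiableOn ℂ g (ball 0 1))
    (hg1 : ∀ z ∈ ball (0 : ℂ) 1, ‖g z‖ ≤ 1) (hg0 : g 0 ≠ 0) (S : Finset (DiscZeroMult g)) :
    ∃ h : ℂ → ℂ, DifferentiableOn ℂ h (ball 0 1) ∧ (∀ z ∈ ball (0 : ℂ) 1, ‖h z‖ ≤ 1) ∧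
      ∀ z ∈ ball (0 : ℂ) 1, g z = (∏ i ∈ S, blaschkeFactor i.1 z) * h z := by
  classical
  obtain ⟨h, hh, hh1, -, hgh⟩ :=
    exists_eq_prod_blaschkeFactor_mul_of_ne_zero hg hg1 hg0 (S.image Sigma.fst)
  set S' := (S.image Sigma.fst).sigma
    (fun a => (Finset.univ : Finset (Fin (analyticOrderNatAt g a)))) with hS'
  have hsub : S ⊆ S' := fun i hi => by
    rw [hS', Finset.mem_sigma]
    exact ⟨Finset.mem_image_of_mem _ hi, Finset.mem_univ _⟩
  refine ⟨fun z => (∏ i ∈ S' \ S, blaschkeFactor i.1 z) * h z, ?_, fun z hz => ?_, fun z hz => ?_⟩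
  · exact (DifferentiableOn.fun_finsetProd fun i _ =>
      differentiableOn_blaschkeFactor i.1.2.1).fun_mul hh
  · rw [norm_mul, norm_prod]
    exact mul_le_one₀ (Finset.prod_le_one (fun _ _ => norm_nonneg _) fun i _ =>
      norm_blaschkeFactor_le_one i.1.2.1 (mem_ball_zero_iff.1 hz).le) (norm_nonneg _) (hh1 z hz)
  · rw [hgh z hz, ← Finset.prod_sdiff hsub]
    ring

lemma norm_apply_zero_eq {g h : ℂ → ℂ} (hg0 : g 0 ≠ 0) {S : Finset (DiscZeroMult g)}
    (hgh : g 0 = (∏ i ∈ S, blaschkeFactor i.1 0) * h 0) :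
    g 0 = ((∏ i ∈ S, ‖(i.1 : ℂ)‖ : ℝ) : ℂ) * h 0 := by
  rw [hgh]
  push_cast
  congr 1
  exact Finset.prod_congr rfl fun i _ => blaschkeFactor_apply_zero (discZero_ne_zero hg0 i.1)

lemma exists_exp_circleAverage_mul_prod_le {g : ℂ → ℂ} (hg : DifferentiableOn ℂ g (ball 0 1))
    (hg1 : ∀ z ∈ ball (0 : ℂ) 1, ‖g z‖ ≤ 1) (hg0 : g 0 ≠ 0) {r : ℝ} (hr0 : 0 < r) (hr : r < 1) :
    ∃ S : Finset (DiscZeroMult g),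
      Real.exp (Real.circleAverage (fun z => Real.log ‖g z‖) 0 r) * ∏ i ∈ S, ‖(i.1 : ℂ)‖ ≤
        ‖g 0‖ := by
  classical
  have hfin := finite_zeros_closedBall hg hg0 hr
  have hsub : closedBall (0 : ℂ) |r| ⊆ ball 0 1 := by
    rw [abs_of_pos hr0]; exact closedBall_subset_ball hr
  have hfinT : {a : DiscZero g | (a : ℂ) ∈ closedBall (0 : ℂ) r}.Finite :=
    Set.Finite.of_finite_image (f := Subtype.val)
      (hfin.subset (by rintro _ ⟨a, ha, rfl⟩; exact ⟨ha, a.2.2⟩)) Subtype.val_injective.injOn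
  obtain ⟨h, hh, hh1, hhT, hgh⟩ :=
    exists_eq_prod_blaschkeFactor_mul_of_ne_zero hg hg1 hg0 hfinT.toFinset
  have hne : ∀ z ∈ closedBall (0 : ℂ) |r|, h z ≠ 0 := by
    intro z hz hz0
    have hzb := hsub hz
    have hgz : g z = 0 := by rw [hgh z hzb, hz0, mul_zero]
    refine hhT ⟨z, mem_ball_zero_iff.1 hzb, hgz⟩ ?_ hz0
    simpa [abs_of_pos hr0] using hz
  have hha : AnalyticOnNhd ℂ h (closedBall (0 : ℂ) |r|) :=
    (hh.analyticOnNhd isOpen_ball).mono hsub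
  have hga : AnalyticOnNhd ℂ g (closedBall (0 : ℂ) |r|) :=
    (hg.analyticOnNhd isOpen_ball).mono hsub
  have hmean := AnalyticOnNhd.circleAverage_log_norm_of_ne_zero hha hne
  have hle : Real.circleAverage (fun z => Real.log ‖g z‖) 0 r ≤
      Real.circleAverage (fun z => Real.log ‖h z‖) 0 r := by
    rw [Real.circleAverage_def, Real.circleAverage_def, smul_eq_mul, smul_eq_mul]
    refine mul_le_mul_of_nonneg_left ?_ (by positivity)
    refine intervalIntegral.integral_mono_ae (by positivity)
      (hga.mono sphere_subset_closedBall).meromorphicOn.circleIntegrable_log_norm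
      (hha.mono sphere_subset_closedBall).meromorphicOn.circleIntegrable_log_norm ?_
    have hcount := (hfin.countable.preimage_circleMap 0 hr0.ne').ae_notMem volume
    filter_upwards [hcount] with t ht
    have htm : circleMap 0 r t ∈ closedBall (0 : ℂ) r := circleMap_mem_closedBall _ hr0.le _
    have hgt : g (circleMap 0 r t) ≠ 0 := fun h0 => ht ⟨htm, h0⟩
    have htb := closedBall_subset_ball hr htm
    refine Real.log_le_log (norm_pos_iff.2 hgt) ?_
    rw [hgh _ htb, norm_mul, norm_prod]
    exact mul_le_of_le_one_left (norm_nonneg _) (Finset.prod_le_one (fun _ _ => norm_nonneg _)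
      fun i _ => norm_blaschkeFactor_le_one i.1.2.1 (mem_ball_zero_iff.1 htb).le)
  have h0 := norm_apply_zero_eq hg0 (hgh 0 (mem_ball_self one_pos))
  refine ⟨hfinT.toFinset.sigma fun _ => Finset.univ, ?_⟩
  rw [h0, norm_mul, mul_comm, Complex.norm_real, Real.norm_of_nonneg
    (Finset.prod_nonneg fun _ _ => norm_nonneg _)]
  refine mul_le_mul_of_nonneg_left ?_ (Finset.prod_nonneg fun _ _ => norm_nonneg _)
  rw [← Real.exp_log (norm_pos_iff.2 (hne 0 (by simp))), ← hmean]
  exact Real.exp_le_exp.2 hle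

lemma summable_one_sub_norm_discZeroMult {g : ℂ → ℂ} (hg : DifferentiableOn ℂ g (ball 0 1))
    (hg1 : ∀ z ∈ ball (0 : ℂ) 1, ‖g z‖ ≤ 1) (hg0 : g 0 ≠ 0) :
    Summable (fun i : DiscZeroMult g => 1 - ‖(i.1 : ℂ)‖) := by
  refine summable_of_sum_le (c := -Real.log ‖g 0‖) (fun i => (sub_pos.2 i.1.2.1).le) fun S => ?_
  obtain ⟨h, -, hh1, hgh⟩ := exists_eq_prod_blaschkeFactor_mul hg hg1 hg0 S
  have hmem : (0 : ℂ) ∈ ball (0 : ℂ) 1 := mem_ball_self one_pos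
  have hpos : ∀ i : DiscZeroMult g, 0 < ‖(i.1 : ℂ)‖ := fun i =>
    norm_pos_iff.2 (discZero_ne_zero hg0 i.1)
  have hle : ‖g 0‖ ≤ ∏ i ∈ S, ‖(i.1 : ℂ)‖ := by
    rw [norm_apply_zero_eq hg0 (hgh 0 hmem), norm_mul, Complex.norm_real, Real.norm_of_nonneg
      (Finset.prod_nonneg fun _ _ => norm_nonneg _)]
    exact mul_le_of_le_one_right (Finset.prod_nonneg fun _ _ => norm_nonneg _) (hh1 0 hmem)
  have hlog := Real.log_le_log (norm_pos_iff.2 hg0) hle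
  rw [Real.log_prod (fun i _ => (hpos i).ne')] at hlog
  calc ∑ i ∈ S, (1 - ‖(i.1 : ℂ)‖) ≤ ∑ i ∈ S, -Real.log ‖(i.1 : ℂ)‖ :=
        Finset.sum_le_sum fun i _ => by linarith [Real.log_le_sub_one_of_pos (hpos i)]
    _ ≤ -Real.log ‖g 0‖ := by rw [Finset.sum_neg_distrib]; linarith

/-- A function bounded by one on the disc whose value at `0` is almost unimodular is almost
constant. -/
lemma norm_sub_le_of_norm_apply_zero {h : ℂ → ℂ} (hh : DifferentiableOn ℂ h (ball 0 1))
    (hh1 : ∀ z ∈ ball (0 : ℂ) 1, ‖h z‖ ≤ 1) {c : ℂ} (hc : ‖c‖ = 1) {δ : ℝ} (hδ : 0 < δ)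
    (h0 : ‖c - h 0‖ ≤ δ) {z : ℂ} (hz : ‖z‖ < 1) :
    ‖c - h z‖ ≤ δ + 2 * δ * ‖z‖ / (1 - ‖z‖) := by
  have hcc : (starRingEnd ℂ) c * c = 1 := by
    rw [← Complex.normSq_eq_conj_mul_self, Complex.normSq_eq_norm_sq, hc]; simp
  have key := Complex.borelCaratheodory_zero (f := fun w => (starRingEnd ℂ) c * (h w - h 0))
    (M := δ) (R := 1) (z := z) hδ ((hh.sub_const _).const_mul _) ?_ one_pos
    (mem_ball_zero_iff.2 hz) (by simp)
  · rw [norm_mul, RCLike.norm_conj, hc, one_mul] at key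
    calc ‖c - h z‖ = ‖(c - h 0) - (h z - h 0)‖ := by ring_nf
      _ ≤ ‖c - h 0‖ + ‖h z - h 0‖ := norm_sub_le _ _
      _ ≤ _ := add_le_add h0 key
  · intro w hw
    have e : (starRingEnd ℂ) c * (h w - h 0) =
        (starRingEnd ℂ) c * h w - 1 + (starRingEnd ℂ) c * (c - h 0) := by
      rw [mul_sub, mul_sub, hcc]; ring
    have h1 : ((starRingEnd ℂ) c * h w).re ≤ 1 := (Complex.re_le_norm _).trans (by
      rw [norm_mul, RCLike.norm_conj, hc, one_mul]; exact hh1 w hw)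
    have h2 : ((starRingEnd ℂ) c * (c - h 0)).re ≤ δ := (Complex.re_le_norm _).trans (by
      rw [norm_mul, RCLike.norm_conj, hc, one_mul]; exact h0)
    change ((starRingEnd ℂ) c * (h w - h 0)).re ≤ δ
    rw [e, Complex.add_re, Complex.sub_re, Complex.one_re]
    linarith

lemma hasProd_blaschkeFactor {g : ℂ → ℂ} (hg : DifferentiableOn ℂ g (ball 0 1))
    (hg1 : ∀ z ∈ ball (0 : ℂ) 1, ‖g z‖ ≤ 1) (hg0 : g 0 ≠ 0)
    (hmean : ∀ ε > 0, ∃ r : ℝ, 0 < r ∧ r < 1 ∧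
      -ε ≤ Real.circleAverage (fun z => Real.log ‖g z‖) 0 r)
    {z : ℂ} (hz : z ∈ ball (0 : ℂ) 1) :
    HasProd (fun i : DiscZeroMult g => blaschkeFactor i.1 z) (g z / (g 0 / ‖g 0‖)) := by
  choose H hH hH1 hgH using exists_eq_prod_blaschkeFactor_mul hg hg1 hg0
  set c : ℂ := g 0 / ‖g 0‖ with hc_def
  have hmem : (0 : ℂ) ∈ ball (0 : ℂ) 1 := mem_ball_self one_pos
  have hg0' : 0 < ‖g 0‖ := norm_pos_iff.2 hg0
  have hc : ‖c‖ = 1 := by rw [hc_def, norm_div, Complex.norm_real, norm_norm, div_self hg0'.ne']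
  have hc0 : c ≠ 0 := norm_ne_zero_iff.1 (by rw [hc]; exact one_ne_zero)
  have hppos : ∀ S : Finset (DiscZeroMult g), 0 < ∏ i ∈ S, ‖(i.1 : ℂ)‖ := fun S =>
    Finset.prod_pos fun i _ => norm_pos_iff.2 (discZero_ne_zero hg0 i.1)
  have hH0 : ∀ S, H S 0 = c * ‖H S 0‖ := by
    intro S
    have h1 := norm_apply_zero_eq hg0 (hgH S 0 hmem)
    have h2 : ‖g 0‖ = (∏ i ∈ S, ‖(i.1 : ℂ)‖) * ‖H S 0‖ := by
      conv_lhs => rw [h1]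
      rw [norm_mul, Complex.norm_real, Real.norm_of_nonneg (hppos S).le]
    have hp : ((∏ i ∈ S, ‖(i.1 : ℂ)‖ : ℝ) : ℂ) ≠ 0 := Complex.ofReal_ne_zero.2 (hppos S).ne'
    have hHS : (‖H S 0‖ : ℂ) ≠ 0 := by
      rw [Complex.ofReal_ne_zero]
      intro h; rw [h, mul_zero] at h2; exact hg0'.ne' h2
    rw [hc_def, h2, h1]
    push_cast at hp ⊢
    field_simp
  have hlim0 : Tendsto (fun S => H S 0) atTop (𝓝 c) := by
    rw [Metric.tendsto_atTop]
    intro ε hε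
    obtain ⟨r, hr0, hr1, hr⟩ := hmean (ε / 2) (by positivity)
    obtain ⟨S₀, hS₀⟩ := exists_exp_circleAverage_mul_prod_le hg hg1 hg0 hr0 hr1
    refine ⟨S₀, fun S hS => ?_⟩
    have h2 : ‖g 0‖ = (∏ i ∈ S, ‖(i.1 : ℂ)‖) * ‖H S 0‖ := by
      conv_lhs => rw [norm_apply_zero_eq hg0 (hgH S 0 hmem)]
      rw [norm_mul, Complex.norm_real, Real.norm_of_nonneg (hppos S).le]
    have hmono : ∏ i ∈ S, ‖(i.1 : ℂ)‖ ≤ ∏ i ∈ S₀, ‖(i.1 : ℂ)‖ := by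
      classical
      rw [← Finset.prod_sdiff hS]
      exact mul_le_of_le_one_left (hppos _).le
        (Finset.prod_le_one (fun _ _ => norm_nonneg _) fun i _ => i.1.2.1.le)
    have h3 : Real.exp (-(ε / 2)) * ∏ i ∈ S, ‖(i.1 : ℂ)‖ ≤ ‖g 0‖ :=
      le_trans (mul_le_mul (Real.exp_le_exp.2 hr) hmono (hppos S).le (Real.exp_pos _).le) hS₀
    rw [h2, mul_comm] at h3
    have h4 := le_of_mul_le_mul_left h3 (hppos S)
    have h5 := Real.add_one_le_exp (-(ε / 2))
    have h6 := hH1 S 0 hmem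
    rw [dist_eq_norm, hH0 S, ← mul_sub_one, norm_mul, hc, one_mul]
    rw [← Complex.ofReal_one, ← Complex.ofReal_sub, Complex.norm_real, Real.norm_eq_abs, abs_lt]
    constructor <;> linarith
  have hz1 : ‖z‖ < 1 := mem_ball_zero_iff.1 hz
  have hlim : Tendsto (fun S => H S z) atTop (𝓝 c) := by
    rw [tendsto_iff_norm_sub_tendsto_zero]
    have hK : 0 < 1 + 2 * ‖z‖ / (1 - ‖z‖) := by
      have : 0 < 1 - ‖z‖ := by linarith
      positivity
    rw [Metric.tendsto_atTop] at hlim0 ⊢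
    intro ε hε
    obtain ⟨S₀, hS₀⟩ := hlim0 (ε / 2 / (1 + 2 * ‖z‖ / (1 - ‖z‖))) (by positivity)
    refine ⟨S₀, fun S hS => ?_⟩
    have h1 := (hS₀ S hS).le
    rw [dist_comm, dist_eq_norm] at h1
    have h2 := norm_sub_le_of_norm_apply_zero (hH S) (hH1 S) hc (by positivity) h1 hz1
    rw [dist_zero_right, norm_norm, norm_sub_rev]
    refine lt_of_le_of_lt h2 ?_
    calc _ = ε / 2 := by field_simp
      _ < ε := by linarith
  refine (tendsto_const_nhds.div hlim hc0).congr' ?_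
  filter_upwards [hlim.eventually_ne hc0] with S hS
  simp only [Pi.div_apply]
  rw [hgH S z hz, mul_div_cancel_right₀ _ hS]

/-- A function bounded by one on the disc, not identically zero near the origin, whose logarithmic
means are arbitrarily close to `0`, is a Blaschke product. -/
theorem isBlaschkeProductOn_of_circleAverage_log_norm {f : ℂ → ℂ}
    (hf : DifferentiableOn ℂ f (ball 0 1)) (hf1 : ∀ z ∈ ball (0 : ℂ) 1, ‖f z‖ ≤ 1)
    (hf0 : analyticOrderAt f 0 ≠ ⊤)
    (hmean : ∀ ε > 0, ∃ r : ℝ, 0 < r ∧ r < 1 ∧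
      -ε ≤ Real.circleAverage (fun z => Real.log ‖f z‖) 0 r) :
    IsBlaschkeProductOn f (ball 0 1) := by
  set m := analyticOrderNatAt f 0 with hm
  obtain ⟨k, hk, hk1, hk0, hfk⟩ := exists_eq_moebius_pow_mul hf hf1 (a := 0) (n := m)
    (by simp) (Nat.cast_analyticOrderNatAt hf0).symm
  set g : ℂ → ℂ := fun z => (-1) ^ m * k z with hg_def
  have hg : DifferentiableOn ℂ g (ball 0 1) := hk.const_mul _
  have hnorm : ∀ z, ‖g z‖ = ‖k z‖ := fun z => by simp [hg_def]
  have hg1 : ∀ z ∈ ball (0 : ℂ) 1, ‖g z‖ ≤ 1 := fun z hz => (hnorm z).trans_le (hk1 z hz)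
  have hg0 : g 0 ≠ 0 := mul_ne_zero (by simp) hk0
  have hfg : ∀ z ∈ ball (0 : ℂ) 1, f z = z ^ m * g z := fun z hz => by
    rw [hfk z hz, hg_def]
    simp only [moebius, zero_sub, map_zero, zero_mul, sub_zero, div_one]
    rw [neg_pow]; ring
  have hmean' : ∀ ε > 0, ∃ r : ℝ, 0 < r ∧ r < 1 ∧
      -ε ≤ Real.circleAverage (fun z => Real.log ‖g z‖) 0 r := by
    intro ε hε
    obtain ⟨r, hr0, hr1, hr⟩ := hmean ε hε
    have hsub : sphere (0 : ℂ) |r| ⊆ ball 0 1 := by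
      rw [abs_of_pos hr0]
      exact sphere_subset_closedBall.trans (closedBall_subset_ball hr1)
    refine ⟨r, hr0, hr1, hr.trans (Real.circleAverage_mono
      ((hf.analyticOnNhd isOpen_ball).mono hsub).meromorphicOn.circleIntegrable_log_norm
      ((hg.analyticOnNhd isOpen_ball).mono hsub).meromorphicOn.circleIntegrable_log_norm
      fun z hz => ?_)⟩
    have hzb := hsub hz
    rw [hfg z hzb]
    by_cases hgz : g z = 0
    · simp [hgz]
    · have hz0 : z ≠ 0 := by
        rintro rfl
        simp at hz
        exact absurd hz (abs_pos.2 hr0.ne').ne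
      refine Real.log_le_log (norm_pos_iff.2 (mul_ne_zero (pow_ne_zero _ hz0) hgz)) ?_
      rw [norm_mul, norm_pow]
      exact mul_le_of_le_one_left (norm_nonneg _)
        (pow_le_one₀ (norm_nonneg _) (mem_ball_zero_iff.1 hzb).le)
  have hsum := summable_one_sub_norm_discZeroMult hg hg1 hg0
  have hcount : Countable (DiscZeroMult g) := by
    have h := hsum.countable_support
    have huniv : Function.support (fun i : DiscZeroMult g => 1 - ‖(i.1 : ℂ)‖) = Set.univ :=
      Set.eq_univ_of_forall fun i => (sub_pos.2 i.1.2.1).ne'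
    rw [huniv] at h
    exact Set.countable_univ_iff.1 h
  have hc : ‖g 0 / (‖g 0‖ : ℂ)‖ = 1 := by
    rw [norm_div, Complex.norm_real, norm_norm, div_self (norm_ne_zero_iff.2 hg0)]
  refine ⟨m, g 0 / ‖g 0‖, DiscZeroMult g, hcount, fun i => i.1, hc,
    fun i => ⟨discZero_ne_zero hg0 i.1, i.1.2.1⟩, hsum, fun z hz => ?_⟩
  have hprod := (hasProd_blaschkeFactor hg hg1 hg0 hmean' hz).tprod_eq
  have hc0 : g 0 / (‖g 0‖ : ℂ) ≠ 0 := norm_ne_zero_iff.1 (by rw [hc]; exact one_ne_zero)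
  simp only [blaschkeFactor, moebius] at hprod
  have hgn : (‖g 0‖ : ℂ) ≠ 0 := Complex.ofReal_ne_zero.2 (norm_ne_zero_iff.2 hg0)
  rw [blaschkeProd, hprod, hfg z hz]
  field_simp

lemma continuous_comp_circleMap {φ : ℂ → ℂ} (hφ : DifferentiableOn ℂ φ (ball 0 1)) {r : ℝ}
    (hr0 : 0 < r) (hr1 : r < 1) : Continuous fun t : ℝ => φ (circleMap 0 r t) :=
  hφ.continuousOn.comp_continuous (continuous_circleMap 0 r) fun t =>
    closedBall_subset_ball hr1 (circleMap_mem_closedBall 0 hr0.le t)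

lemma IsInner.ae_tendsto_norm {φ : ℂ → ℂ} (hφ : IsInner φ) {r : ℕ → ℝ} (hr1 : ∀ n, r n < 1)
    (hr : Tendsto r atTop (𝓝 1)) :
    ∀ᵐ t ∂(volume.restrict (Ioc (0 : ℝ) (2 * π))),
      Tendsto (fun n => ‖φ (circleMap 0 (r n) t)‖) atTop (𝓝 1) := by
  filter_upwards [hφ.2.2] with t ⟨L, hL, ht⟩
  have h := (ht.comp (tendsto_nhdsWithin_iff.2 ⟨hr, Eventually.of_forall hr1⟩)).norm
  rw [hL] at h
  simpa [circleMap, Function.comp_def] using h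

/-- A weak maximum principle: a power of `‖f z‖` is controlled by a mean over a circle. -/
lemma norm_pow_mul_sub_le_circleAverage {f : ℂ → ℂ} (hf : DifferentiableOn ℂ f (ball 0 1))
    {r : ℝ} (hr1 : r < 1) {z : ℂ} (hz : ‖z‖ < r) (k : ℕ) :
    ‖f z‖ ^ k * (r - ‖z‖) ≤ r * Real.circleAverage (fun w => ‖f w‖ ^ k) 0 r := by
  have hr0 : 0 < r := (norm_nonneg z).trans_lt hz
  have hrz : 0 < r - ‖z‖ := sub_pos.2 hz
  have hsub : closedBall (0 : ℂ) r ⊆ ball 0 1 := closedBall_subset_ball hr1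
  have hd : DiffContOnCl ℂ (fun w => f w ^ k) (ball 0 |r|) := by
    rw [abs_of_pos hr0]
    exact ((hf.pow k).mono (closure_ball_subset_closedBall.trans hsub)).diffContOnCl
  have hrep := hd.circleAverage_smul_div (w := z) (by simpa [abs_of_pos hr0] using hz)
  have hcont := continuous_comp_circleMap hf hr0 hr1
  have hmem : ∀ t, ‖circleMap 0 r t‖ = r := fun t => by simp [abs_of_pos hr0]
  have hb : ∀ t, r - ‖z‖ ≤ ‖circleMap 0 r t - z‖ := fun t => by
    have := norm_sub_norm_le (circleMap 0 r t) z
    rwa [hmem t] at this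
  rw [← norm_pow, ← hrep, Real.circleAverage_def, Real.circleAverage_def, norm_smul,
    Real.norm_of_nonneg (by positivity), smul_eq_mul, mul_assoc, mul_left_comm r]
  refine mul_le_mul_of_nonneg_left ?_ (by positivity)
  rw [← le_div_iff₀ hrz, mul_div_right_comm, ← intervalIntegral.integral_const_mul]
  refine intervalIntegral.norm_integral_le_of_norm_le (by positivity) ?_
    ((continuous_const.mul (hcont.norm.pow k)).intervalIntegrable _ _)
  refine Eventually.of_forall fun t _ => ?_
  rw [sub_zero, norm_smul, norm_div, hmem t, norm_pow]
  gcongr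
  exact hb t

lemma IsInner.norm_le_one {φ : ℂ → ℂ} (hφ : IsInner φ) {z : ℂ} (hz : ‖z‖ < 1) : ‖φ z‖ ≤ 1 := by
  obtain ⟨r, -, hr, hlim⟩ := exists_seq_strictMono_tendsto' (zero_lt_one' ℝ)
  obtain ⟨C, hC⟩ := hφ.2.1
  have key : ∀ k : ℕ, ‖φ z‖ ^ k * (1 - ‖z‖) ≤ 1 := by
    intro k
    have havg : Tendsto (fun n => Real.circleAverage (fun w => ‖φ w‖ ^ k) 0 (r n)) atTop
        (𝓝 1) := by
      have h : Tendsto (fun n => ∫ t in Ioc (0 : ℝ) (2 * π), ‖φ (circleMap 0 (r n) t)‖ ^ k) atTop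
          (𝓝 (∫ _ in Ioc (0 : ℝ) (2 * π), (1 : ℝ))) := by
        refine tendsto_integral_of_dominated_convergence (fun _ => C ^ k)
          (fun n => ?_) (integrable_const _) (fun n => ?_) ?_
        · exact ((continuous_comp_circleMap hφ.1 (hr n).1 (hr n).2).norm.pow k).aestronglyMeasurable
        · refine Eventually.of_forall fun t => ?_
          rw [Real.norm_of_nonneg (by positivity)]
          gcongr
          exact hC _ (closedBall_subset_ball (hr n).2 (circleMap_mem_closedBall 0 (hr n).1.le t))
        · filter_upwards [hφ.ae_tendsto_norm (fun n => (hr n).2) hlim] with t ht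
          simpa using ht.pow k
      have h2 := h.const_mul (2 * π)⁻¹
      simp only [Real.circleAverage_def, intervalIntegral.integral_of_le Real.two_pi_pos.le,
        smul_eq_mul]
      convert h2 using 2
      simp [Real.pi_pos.le]
      field_simp
    have h1 := (hlim.sub_const ‖z‖).const_mul (‖φ z‖ ^ k)
    have h2 := hlim.mul havg
    rw [one_mul] at h2
    refine le_of_tendsto_of_tendsto h1 h2 ?_
    filter_upwards [hlim.eventually_const_lt hz] with n hn
    exact norm_pow_mul_sub_le_circleAverage hφ.1 (hr n).2 hn k
  by_contra! h
  obtain ⟨k, hk⟩ := pow_unbounded_of_one_lt (1 / (1 - ‖z‖)) h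
  rw [div_lt_iff₀ (by linarith)] at hk
  exact absurd (key k) hk.not_ge

lemma one_sub_mul_conj_ne_zero {w ζ : ℂ} (hw : ‖w‖ < 1) (hζ : ‖ζ‖ ≤ 1) :
    1 - w * (starRingEnd ℂ) ζ ≠ 0 := by
  have h := (map_ne_zero (starRingEnd ℂ)).2 (one_sub_conj_mul_ne_zero hw hζ)
  simpa using h

/-- The mean of `log ‖moebius w ζ‖` over the circle `‖w‖ = ρ`. -/
lemma lintegral_neg_log_norm_moebius {ρ : ℝ} (hρ0 : 0 < ρ) (hρ1 : ρ < 1) {ζ : ℂ} (hζ : ‖ζ‖ ≤ 1) :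
    ∫⁻ θ in Ioc (0 : ℝ) (2 * π), ENNReal.ofReal (-Real.log ‖moebius (circleMap 0 ρ θ) ζ‖) =
      ENNReal.ofReal (2 * π * -Real.log (max ρ ‖ζ‖)) := by
  have hw : ∀ θ, ‖circleMap 0 ρ θ‖ < 1 := fun θ => by simpa [abs_of_pos hρ0] using hρ1
  have hball : closedBall (0 : ℂ) |ρ| ⊆ ball 0 1 := by
    rw [abs_of_pos hρ0]; exact closedBall_subset_ball hρ1
  have hden : AnalyticOnNhd ℂ (fun w => 1 - w * (starRingEnd ℂ) ζ) (closedBall (0 : ℂ) |ρ|) :=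
    fun w _ => by fun_prop
  have hi1 : CircleIntegrable (fun w => Real.log ‖w - ζ‖) 0 ρ :=
    circleIntegrable_log_norm_sub_const ρ
  have hi2 : CircleIntegrable (fun w => Real.log ‖1 - w * (starRingEnd ℂ) ζ‖) 0 ρ :=
    (hden.mono sphere_subset_closedBall).meromorphicOn.circleIntegrable_log_norm
  have ha1 := circleAverage_log_norm_sub_const_eq_log_radius_add_posLog (a := ζ) (c := 0) hρ0.ne'
  have ha2 := AnalyticOnNhd.circleAverage_log_norm_of_ne_zero hden fun w hw' =>
    one_sub_mul_conj_ne_zero (mem_ball_zero_iff.1 (hball hw')) hζ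
  rw [zero_mul, sub_zero, norm_one, Real.log_one] at ha2
  have hae : ∀ᵐ θ ∂(volume.restrict (Ioc (0 : ℝ) (2 * π))),
      Real.log ‖moebius (circleMap 0 ρ θ) ζ‖ = Real.log ‖circleMap 0 ρ θ - ζ‖ -
        Real.log ‖1 - circleMap 0 ρ θ * (starRingEnd ℂ) ζ‖ := by
    have hcount := (((Set.countable_singleton ζ).preimage_circleMap 0 hρ0.ne').ae_notMem volume)
    filter_upwards [ae_restrict_of_ae hcount] with θ hθ
    have hne : circleMap 0 ρ θ - ζ ≠ 0 := fun h => hθ (sub_eq_zero.1 h)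
    have hconj : ‖1 - circleMap 0 ρ θ * (starRingEnd ℂ) ζ‖ =
        ‖1 - (starRingEnd ℂ) (circleMap 0 ρ θ) * ζ‖ := by
      rw [← RCLike.norm_conj]; simp
    rw [moebius, norm_div, Real.log_div (norm_ne_zero_iff.2 hne)
      (norm_ne_zero_iff.2 (one_sub_conj_mul_ne_zero (hw θ) hζ)), hconj]
  have hinteg := (hi1.sub hi2)
  rw [CircleIntegrable, intervalIntegrable_iff_integrableOn_Ioc_of_le Real.two_pi_pos.le] at hinteg
  have hval : ∫ θ in Ioc (0 : ℝ) (2 * π), -Real.log ‖moebius (circleMap 0 ρ θ) ζ‖ =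
      2 * π * -Real.log (max ρ ‖ζ‖) := by
    rw [integral_neg, integral_congr_ae hae, mul_neg, neg_inj,
      ← intervalIntegral.integral_of_le Real.two_pi_pos.le,
      intervalIntegral.integral_sub hi1 hi2]
    rw [Real.circleAverage_def, smul_eq_mul, inv_mul_eq_iff_eq_mul₀ Real.two_pi_pos.ne'] at ha1 ha2
    rw [ha1, ha2, mul_zero, sub_zero, zero_sub, norm_neg]
    congr 1
    rcases le_total ‖ζ‖ ρ with h | h
    · rw [max_eq_left h, Real.posLog_eq_zero_iff _ |>.2, add_zero]
      rw [abs_of_nonneg (by positivity)]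
      exact inv_mul_le_one_of_le₀ h hρ0.le
    · have hζ0 : 0 < ‖ζ‖ := hρ0.trans_le h
      rw [max_eq_right h, Real.posLog_eq_log, Real.log_mul (by positivity) hζ0.ne', Real.log_inv]
      · ring
      · rw [abs_of_nonneg (by positivity), inv_mul_eq_div, le_div_iff₀ hρ0]; linarith
  rw [← hval, ofReal_integral_eq_lintegral_ofReal]
  · exact (hinteg.congr (hae.mono fun θ h => h.symm)).neg
  · refine Eventually.of_forall fun θ => ?_
    exact neg_nonneg.2 (Real.log_nonpos (norm_nonneg _) (norm_moebius_le_one (hw θ) hζ))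

/-- For almost every shift parameter on a circle, the logarithmic means of the Frostman shift come
arbitrarily close to `0`. -/
lemma IsInner.ae_exists_circleAverage_ge {φ : ℂ → ℂ} (hφ : IsInner φ) {ρ : ℝ} (hρ0 : 0 < ρ)
    (hρ1 : ρ < 1) :
    ∀ᵐ θ ∂(volume.restrict (Ioc (0 : ℝ) (2 * π))), ∀ ε > 0, ∃ r : ℝ, 0 < r ∧ r < 1 ∧
      -ε ≤ Real.circleAverage (fun z => Real.log ‖moebius (circleMap 0 ρ θ) (φ z)‖) 0 r := by
  obtain ⟨r, -, hr, hlim⟩ := exists_seq_strictMono_tendsto' (zero_lt_one' ℝ)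
  set μ := volume.restrict (Ioc (0 : ℝ) (2 * π)) with hμ
  have hmem : ∀ n t, circleMap 0 (r n) t ∈ ball (0 : ℂ) 1 := fun n t =>
    closedBall_subset_ball (hr n).2 (circleMap_mem_closedBall 0 (hr n).1.le t)
  have hle : ∀ n t, ‖φ (circleMap 0 (r n) t)‖ ≤ 1 := fun n t =>
    hφ.norm_le_one (mem_ball_zero_iff.1 (hmem n t))
  have hcont : ∀ n, Continuous fun t => φ (circleMap 0 (r n) t) := fun n =>
    continuous_comp_circleMap hφ.1 (hr n).1 (hr n).2
  have hw : ∀ θ, ‖circleMap 0 ρ θ‖ < 1 := fun θ => by simpa [abs_of_pos hρ0] using hρ1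
  have hmeas : ∀ n, Measurable fun p : ℝ × ℝ =>
      Real.log ‖moebius (circleMap 0 ρ p.1) (φ (circleMap 0 (r n) p.2))‖ := by
    intro n
    have h1 : Measurable fun p : ℝ × ℝ => circleMap 0 ρ p.1 :=
      ((continuous_circleMap 0 ρ).comp continuous_fst).measurable
    have h2 : Measurable fun p : ℝ × ℝ => φ (circleMap 0 (r n) p.2) :=
      ((hcont n).comp continuous_snd).measurable
    have h3 : Measurable fun p : ℝ × ℝ => (starRingEnd ℂ) (circleMap 0 ρ p.1) :=
      Complex.continuous_conj.measurable.comp h1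
    exact Real.measurable_log.comp ((h1.sub h2).div (measurable_const.sub (h3.mul h2))).norm
  set F : ℕ → ℝ → ℝ → ENNReal := fun n θ t =>
    ENNReal.ofReal (-Real.log ‖moebius (circleMap 0 ρ θ) (φ (circleMap 0 (r n) t))‖) with hF
  have hFm : ∀ n, Measurable (Function.uncurry (F n)) := fun n => (hmeas n).neg.ennreal_ofReal
  have htend : Tendsto (fun n => ∫⁻ θ, ∫⁻ t, F n θ t ∂μ ∂μ) atTop (𝓝 0) := by
    have heq : ∀ n, ∫⁻ θ, ∫⁻ t, F n θ t ∂μ ∂μ =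
        ∫⁻ t, ENNReal.ofReal (2 * π * -Real.log (max ρ ‖φ (circleMap 0 (r n) t)‖)) ∂μ := by
      intro n
      rw [lintegral_lintegral_swap (hFm n).aemeasurable]
      exact lintegral_congr fun t => lintegral_neg_log_norm_moebius hρ0 hρ1 (hle n t)
    simp_rw [heq]
    rw [← lintegral_zero (μ := μ)]
    refine tendsto_lintegral_of_dominated_convergence
      (fun _ => ENNReal.ofReal (2 * π * -Real.log ρ)) (fun n => ?_) (fun n => ?_) ?_ ?_
    · exact ((Real.measurable_log.comp (measurable_const.max
        (hcont n).norm.measurable)).neg.const_mul _).ennreal_ofReal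
    · refine Eventually.of_forall fun t => ENNReal.ofReal_le_ofReal ?_
      have := Real.log_le_log hρ0 (le_max_left ρ ‖φ (circleMap 0 (r n) t)‖)
      exact mul_le_mul_of_nonneg_left (neg_le_neg this) Real.two_pi_pos.le
    · rw [lintegral_const]
      exact ENNReal.mul_ne_top ENNReal.ofReal_ne_top (measure_ne_top _ _)
    · filter_upwards [hφ.ae_tendsto_norm (fun n => (hr n).2) hlim] with t ht
      have h1 : Tendsto (fun n => max ρ ‖φ (circleMap 0 (r n) t)‖) atTop (𝓝 1) := by
        simpa [max_eq_right hρ1.le] using (tendsto_const_nhds (x := ρ)).max ht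
      have h2 := ((h1.log one_ne_zero).neg.const_mul (2 * π))
      simpa using ENNReal.tendsto_ofReal h2
  have hG : ∀ n, Measurable fun θ => ∫⁻ t, F n θ t ∂μ := fun n => (hFm n).lintegral_prod_right
  have hfatou : ∫⁻ θ, liminf (fun n => ∫⁻ t, F n θ t ∂μ) atTop ∂μ = 0 :=
    le_antisymm ((lintegral_liminf_le hG).trans htend.liminf_eq.le) zero_le
  rw [lintegral_eq_zero_iff (.liminf hG)] at hfatou
  filter_upwards [hfatou] with θ hθ ε hε
  have hlt : liminf (fun n => ∫⁻ t, F n θ t ∂μ) atTop < ENNReal.ofReal (2 * π * ε) := by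
    rw [hθ]; simpa using by positivity
  obtain ⟨n, hn⟩ := (frequently_lt_of_liminf_lt (by isBoundedDefault) hlt).exists
  refine ⟨r n, (hr n).1, (hr n).2, ?_⟩
  have hnonneg : ∀ t, 0 ≤ -Real.log ‖moebius (circleMap 0 ρ θ) (φ (circleMap 0 (r n) t))‖ :=
    fun t => neg_nonneg.2 (Real.log_nonpos (norm_nonneg _) (norm_moebius_le_one (hw θ) (hle n t)))
  have hinteg : ∫ t, -Real.log ‖moebius (circleMap 0 ρ θ) (φ (circleMap 0 (r n) t))‖ ∂μ ≤
      2 * π * ε := by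
    rw [integral_eq_lintegral_of_nonneg_ae (Eventually.of_forall hnonneg)
      ((hmeas n).comp measurable_prodMk_left).neg.aestronglyMeasurable]
    exact ENNReal.toReal_le_of_le_ofReal (by positivity) hn.le
  rw [integral_neg] at hinteg
  rw [Real.circleAverage_def, intervalIntegral.integral_of_le Real.two_pi_pos.le, smul_eq_mul,
    ← hμ, ← mul_le_mul_iff_right₀ Real.two_pi_pos, mul_inv_cancel_left₀ Real.two_pi_pos.ne']
  linarith

lemma IsInner.exists_ne {φ : ℂ → ℂ} (hφ : IsInner φ) {w : ℂ} (hw : ‖w‖ < 1) :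
    ∃ z ∈ ball (0 : ℂ) 1, φ z ≠ w := by
  by_contra! h
  obtain ⟨r, -, hr, hlim⟩ := exists_seq_strictMono_tendsto' (zero_lt_one' ℝ)
  have : NeBot (ae (volume.restrict (Ioc (0 : ℝ) (2 * π)))) := by
    rw [ae_neBot, Ne, Measure.restrict_eq_zero, Real.volume_Ioc]
    simpa using Real.pi_pos
  obtain ⟨t, ht⟩ := (hφ.ae_tendsto_norm (fun n => (hr n).2) hlim).exists
  have heq : ∀ n, ‖φ (circleMap 0 (r n) t)‖ = ‖w‖ := fun n => by
    rw [h _ (closedBall_subset_ball (hr n).2 (circleMap_mem_closedBall 0 (hr n).1.le t))]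
  simp_rw [heq] at ht
  exact hw.ne (tendsto_nhds_unique tendsto_const_nhds ht)

lemma IsInner.differentiableOn_moebius_comp {φ : ℂ → ℂ} (hφ : IsInner φ) {w : ℂ} (hw : ‖w‖ < 1) :
    DifferentiableOn ℂ (fun z => moebius w (φ z)) (ball 0 1) := by
  have hd := hφ.1
  unfold moebius
  refine DifferentiableOn.div (by fun_prop) (by fun_prop) fun z hz => ?_
  exact one_sub_conj_mul_ne_zero hw (hφ.norm_le_one (mem_ball_zero_iff.1 hz))

lemma IsInner.analyticOrderAt_moebius_comp_ne_top {φ : ℂ → ℂ} (hφ : IsInner φ) {w : ℂ}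
    (hw : ‖w‖ < 1) : analyticOrderAt (fun z => moebius w (φ z)) 0 ≠ ⊤ := by
  intro htop
  obtain ⟨z, hz, hne⟩ := hφ.exists_ne hw
  have h := ((hφ.differentiableOn_moebius_comp hw).analyticOnNhd
    isOpen_ball).eqOn_zero_of_preconnected_of_eventuallyEq_zero
    (convex_ball (0 : ℂ) 1).isPreconnected (mem_ball_self one_pos) (analyticOrderAt_eq_top.1 htop)
  have h0 : moebius w (φ z) = 0 := h hz
  refine div_ne_zero (sub_ne_zero.2 hne.symm) ?_ h0
  exact one_sub_conj_mul_ne_zero hw (hφ.norm_le_one (mem_ball_zero_iff.1 hz))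

/-- **Frostman's theorem.** For an inner function `φ` and `0 < ρ < 1`, for almost every
`θ ∈ [0, 2π]` the Frostman shift `(ρe^{iθ} − φ)/(1 − conj(ρe^{iθ})·φ)` is a Blaschke product. -/
theorem frostman_shift_blaschke (φ : ℂ → ℂ) (hφ : IsInner φ)
    (ρ : ℝ) (hρ0 : 0 < ρ) (hρ1 : ρ < 1) :
    volume {θ : ℝ | θ ∈ Set.Icc (0:ℝ) (2*π) ∧
      ¬ IsBlaschkeProductOn
          (fun z => (((ρ : ℂ) * Complex.exp ((θ : ℂ) * Complex.I)) - φ z) /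
            (1 - (starRingEnd ℂ) ((ρ : ℂ) * Complex.exp ((θ : ℂ) * Complex.I)) * φ z))
          (ball (0:ℂ) 1)} = 0 := by
  have hae : ∀ᵐ θ ∂(volume.restrict (Icc (0 : ℝ) (2 * π))),
      IsBlaschkeProductOn (fun z => moebius (circleMap 0 ρ θ) (φ z)) (ball 0 1) := by
    rw [← restrict_Ioc_eq_restrict_Icc]
    filter_upwards [hφ.ae_exists_circleAverage_ge hρ0 hρ1] with θ hθ
    have hw : ‖circleMap 0 ρ θ‖ < 1 := by simpa [abs_of_pos hρ0] using hρ1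
    exact isBlaschkeProductOn_of_circleAverage_log_norm (hφ.differentiableOn_moebius_comp hw)
      (fun z hz => norm_moebius_le_one hw (hφ.norm_le_one (mem_ball_zero_iff.1 hz)))
      (hφ.analyticOrderAt_moebius_comp_ne_top hw) hθ
  rw [ae_restrict_iff' measurableSet_Icc] at hae
  simpa [ae_iff, moebius, circleMap, and_assoc] using hae
end
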